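/- arXiv:2410.15984 — 2 statements merged into one kernel-verified Lean document; each statement's English description precedes it below -/
import Mathlib

section
/- Let J be a symmetric 3×3 real matrix, m > 0, and let U : Matrix(3,3,ℝ) × ℝ³ → ℝ be (Fréchet) differentiable. Let p, v, ω : ℝ → ℝ³ and R : ℝ → Matrix(3,3,ℝ) be differentiable curves and f', τ', a : ℝ → ℝ³ arbitrary curves satisfying for all t: p'(t) = v(t), R'(t) = R(t)·ω̃(t), m·v'(t) = f'(t), and J·ω'(t) = −ω(t) × (J·ω(t) − a(t)) + τ'(t). Then the Lyapunov candidate V(t) = (1/2)·m·⟨v(t), v(t)⟩ + (1/2)·⟨ω(t), J·ω(t)⟩ + U(R(t), p(t)) is differentiable with V'(t) = ⟨v(t), f'(t)⟩ + ⟨ω(t), τ'(t)⟩ + DU(R(t), p(t))[(R(t)·ω̃(t), v(t))], an expression that does not involve a; in particular V'(t) is invariant under any choice of the gyroscopic term a ∈ ℝ³. -/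
open Matrix

attribute [local instance] Matrix.normedAddCommGroup Matrix.normedSpace

/-- The hat map: `hat ω` is the skew-symmetric matrix with `(hat ω) ⬝ᵥ b = ω × b`. -/
def hat (ω : Fin 3 → ℝ) : Matrix (Fin 3) (Fin 3) ℝ :=
  !![0, -ω 2, ω 1; ω 2, 0, -ω 0; -ω 1, ω 0, 0]

theorem HasDerivAt.dotProduct {n : Type*} [Fintype n] {x y : ℝ → n → ℝ} {x' y' : n → ℝ} {t : ℝ}
    (hx : HasDerivAt x x' t) (hy : HasDerivAt y y' t) :
    HasDerivAt (fun s => x s ⬝ᵥ y s) (x' ⬝ᵥ y t + x t ⬝ᵥ y') t := by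
  have h := HasDerivAt.fun_sum (u := Finset.univ) fun i _ =>
    (hasDerivAt_pi.1 hx i).mul (hasDerivAt_pi.1 hy i)
  rw [Finset.sum_add_distrib] at h
  exact h

theorem HasDerivAt.matrix_mulVec {m n : Type*} [Fintype m] [Fintype n] {x : ℝ → n → ℝ}
    {x' : n → ℝ} {t : ℝ} (A : Matrix m n ℝ) (hx : HasDerivAt x x' t) :
    HasDerivAt (fun s => A *ᵥ x s) (A *ᵥ x') t :=
  (LinearMap.toContinuousLinearMap A.mulVecLin).hasFDerivAt.comp_hasDerivAt t hx

theorem Matrix.IsSymm.dotProduct_mulVec_comm {n R : Type*} [Fintype n] [CommSemiring R]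
    {A : Matrix n n R} (hA : A.IsSymm) (x y : n → R) : x ⬝ᵥ A *ᵥ y = y ⬝ᵥ A *ᵥ x := by
  rw [dotProduct_mulVec, ← mulVec_transpose, hA.eq, dotProduct_comm]

/-- For the controlled rigid body `ṗ = v`, `Ṙ = R·ω̃`, `m·v' = f'`,
`J·ω' = −ω × (J·ω − a) + τ'` and any Fréchet-differentiable potential `U(R,p)`, the
Lyapunov candidate `V = (1/2)·m·⟨v,v⟩ + (1/2)·⟨ω, J·ω⟩ + U(R,p)` is differentiable
with `V' = ⟨v, f'⟩ + ⟨ω, τ'⟩ + DU(R,p)[(R·ω̃, v)]`, an expression not involving `a`;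
hence `V'` is invariant under any choice of the gyroscopic term `a`. -/
theorem stmt3
    (J : Matrix (Fin 3) (Fin 3) ℝ) (hJ : J.IsSymm)
    (m : ℝ) (hm : 0 < m)
    (U : Matrix (Fin 3) (Fin 3) ℝ × (Fin 3 → ℝ) → ℝ) (hU : Differentiable ℝ U)
    (p v ω v' ω' f' τ' a : ℝ → Fin 3 → ℝ)
    (R : ℝ → Matrix (Fin 3) (Fin 3) ℝ)
    (hp : ∀ t, HasDerivAt p (v t) t)
    (hR : ∀ t, HasDerivAt R (R t * hat (ω t)) t)
    (hv : ∀ t, HasDerivAt v (v' t) t)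
    (hω : ∀ t, HasDerivAt ω (ω' t) t)
    (hdyn_v : ∀ t, m • v' t = f' t)
    (hdyn_ω : ∀ t, J.mulVec (ω' t) =
      -(crossProduct (ω t) (J.mulVec (ω t) - a t)) + τ' t) :
    ∀ t, HasDerivAt
      (fun s => (1/2) * m * (v s ⬝ᵥ v s) + (1/2) * (ω s ⬝ᵥ J.mulVec (ω s)) + U (R s, p s))
      (v t ⬝ᵥ f' t + ω t ⬝ᵥ τ' t + fderiv ℝ U (R t, p t) (R t * hat (ω t), v t)) t := by
  intro t
  have hkin := ((hv t).dotProduct (hv t)).const_mul ((1 / 2) * m)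
  have hrot := ((hω t).dotProduct ((hω t).matrix_mulVec J)).const_mul (1 / 2)
  have hpot : HasDerivAt (fun s => U (R s, p s))
      (fderiv ℝ U (R t, p t) (R t * hat (ω t), v t)) t :=
    (hU (R t, p t)).hasFDerivAt.comp_hasDerivAt t ((hR t).prodMk (hp t))
  have hforce : v t ⬝ᵥ f' t = m * (v t ⬝ᵥ v' t) := by
    rw [← hdyn_v t, dotProduct_smul, smul_eq_mul]
  have htorque : ω t ⬝ᵥ J *ᵥ ω' t = ω t ⬝ᵥ τ' t := by
    rw [hdyn_ω t, dotProduct_add, dotProduct_neg, dot_self_cross, neg_zero, zero_add]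
  refine ((hkin.add hrot).add hpot).congr_deriv ?_
  rw [hJ.dotProduct_mulVec_comm (ω' t) (ω t), htorque, hforce, dotProduct_comm (v' t) (v t)]
  ring
end

section
/- Let J and J_d be invertible 3×3 real matrices and let ω, a, τ' ∈ ℝ³. Then J_d · (J⁻¹ · (−ω × (J·ω − a) + τ')) = −ω × (J_d·ω) + τ' holds if and only if ω̃·a = ω̃·(J·ω) − J·J_d⁻¹·(ω̃·(J_d·ω)) + (J·J_d⁻¹ − I₃)·τ'. That is, the closed-loop rotational dynamics J·ω̇ = −ω × (J·ω − a) + τ' coincides with the dynamics J_d·ω̇ = −ω × (J_d·ω) + τ' of a rigid body with desired inertia J_d exactly when this matching condition on a holds. -/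
open Matrix

theorem hat_mulVec (ω b : Fin 3 → ℝ) : (hat ω).mulVec b = crossProduct ω b := by
  ext i
  fin_cases i <;> simp [hat, Matrix.mulVec, dotProduct, Fin.sum_univ_three, cross_apply] <;> ring

theorem mulVec_inv_mulVec_eq_iff {n R : Type*} [Fintype n] [DecidableEq n] [CommRing R]
    {A B : Matrix n n R} (hA : IsUnit A) (hB : IsUnit B) (x y : n → R) :
    B.mulVec (A⁻¹.mulVec x) = y ↔ x = (A * B⁻¹).mulVec y := by
  rw [Matrix.isUnit_iff_isUnit_det] at hA hB
  constructor
  · rintro rfl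
    simp [Matrix.mulVec_mulVec, Matrix.mul_assoc, Matrix.nonsing_inv_mul_cancel_left, hA, hB]
  · rintro rfl
    simp [Matrix.mulVec_mulVec, Matrix.nonsing_inv_mul_cancel_left, hA, hB]

/-- For invertible inertia matrices `J`, `J_d`, the closed-loop
dynamics `J·ω̇ = −ω × (J·ω − a) + τ'` coincides with the desired dynamics
`J_d·ω̇ = −ω × (J_d·ω) + τ'` (i.e. `J_d·(J⁻¹·(−ω × (J·ω − a) + τ')) = −ω × (J_d·ω) + τ'`)
iff the matching condition
`ω̃·a = ω̃·(J·ω) − J·J_d⁻¹·(ω̃·(J_d·ω)) + (J·J_d⁻¹ − I₃)·τ'` holds. -/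
theorem stmt4
    (J Jd : Matrix (Fin 3) (Fin 3) ℝ) (hJ : IsUnit J) (hJd : IsUnit Jd)
    (ω a τ' : Fin 3 → ℝ) :
    Jd.mulVec (J⁻¹.mulVec (-(crossProduct ω (J.mulVec ω - a)) + τ')) =
      -(crossProduct ω (Jd.mulVec ω)) + τ' ↔
    (hat ω).mulVec a =
      (hat ω).mulVec (J.mulVec ω)
        - (J * Jd⁻¹).mulVec ((hat ω).mulVec (Jd.mulVec ω))
        + (J * Jd⁻¹ - 1).mulVec τ' := by
  rw [mulVec_inv_mulVec_eq_iff hJ hJd]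
  simp only [hat_mulVec, map_sub, Matrix.mulVec_add, Matrix.mulVec_neg, Matrix.sub_mulVec,
    Matrix.one_mulVec]
  constructor <;> intro h <;> linear_combination h
end
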